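/- arXiv:0808.3935 — 5 statements merged into one kernel-verified Lean document; each statement's English description precedes it below -/
import Mathlib

section
/- Let Q and P be groups, let U be a (Q,P)-biset, let u ∈ U, and let (T,S) be a section of Q (so S is a normal subgroup of T). Then Sᵘ is a normal subgroup of Tᵘ, the set-product (S ∩ ᵘP)(T ∩ ᵘ1) is a normal subgroup of T ∩ ᵘP, the set-product (T ∩ ᵘ1)S is a normal subgroup of the subgroup (T ∩ ᵘP)S of T, and there are group isomorphisms Tᵘ/Sᵘ ≅ (T ∩ ᵘP)/((S ∩ ᵘP)(T ∩ ᵘ1)) ≅ (T ∩ ᵘP)S/((T ∩ ᵘ1)S). In particular, Tᵘ/Sᵘ is isomorphic to a subquotient of T/S, i.e. there exist subgroups B ⊴ A of T/S with Tᵘ/Sᵘ ≅ A/B. -/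
open MulOpposite

section BisetDefs
variable {Q P : Type*} [Group Q] [Group P]
variable {U : Type*} [MulAction Q U] [MulAction Pᵐᵒᵖ U] [SMulCommClass Q Pᵐᵒᵖ U]

/-- For a `(Q,P)`-biset `U` (left `Q`-action, right `P`-action written as a `Pᵐᵒᵖ`-action,
the two actions commuting), `u ∈ U` and a subgroup `S ≤ P`, this is the subgroup
`ᵘS = {y ∈ Q | ∃ s ∈ S, u • s = y • u}` of `Q`. -/
def Biset.lsub (u : U) (S : Subgroup P) : Subgroup Q where
  carrier := {y : Q | ∃ s ∈ S, op s • u = y • u}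
  one_mem' := ⟨1, S.one_mem, by simp⟩
  mul_mem' := by
    rintro y z ⟨s, hs, hsu⟩ ⟨s', hs', hsu'⟩
    refine ⟨s * s', S.mul_mem hs hs', ?_⟩
    calc op (s * s') • u = op s' • op s • u := by rw [op_mul, mul_smul]
      _ = op s' • y • u := by rw [hsu]
      _ = y • op s' • u := (smul_comm y (op s') u).symm
      _ = y • z • u := by rw [hsu']
      _ = (y * z) • u := (mul_smul y z u).symm
  inv_mem' := by
    rintro y ⟨s, hs, h⟩
    refine ⟨s⁻¹, S.inv_mem hs, ?_⟩
    have hu : u = y⁻¹ • op s • u := by rw [h, inv_smul_smul]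
    calc op s⁻¹ • u = op s⁻¹ • y⁻¹ • op s • u := by rw [← hu]
      _ = y⁻¹ • op s⁻¹ • op s • u := (smul_comm y⁻¹ (op s⁻¹) _).symm
      _ = y⁻¹ • u := by rw [← mul_smul, ← op_mul, mul_inv_cancel, op_one, one_smul]

/-- For a `(Q,P)`-biset `U`, `u ∈ U` and a subgroup `T ≤ Q`, this is the subgroup
`Tᵘ = {x ∈ P | ∃ t ∈ T, t • u = u • x}` of `P`. -/
def Biset.rsub (u : U) (T : Subgroup Q) : Subgroup P where
  carrier := {x : P | ∃ t ∈ T, t • u = op x • u}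
  one_mem' := ⟨1, T.one_mem, by simp⟩
  mul_mem' := by
    rintro x y ⟨t, ht, htu⟩ ⟨t', ht', htu'⟩
    refine ⟨t * t', T.mul_mem ht ht', ?_⟩
    calc (t * t') • u = t • t' • u := mul_smul t t' u
      _ = t • op y • u := by rw [htu']
      _ = op y • t • u := smul_comm t (op y) u
      _ = op y • op x • u := by rw [htu]
      _ = op (x * y) • u := by rw [op_mul, mul_smul]
  inv_mem' := by
    rintro x ⟨t, ht, h⟩
    refine ⟨t⁻¹, T.inv_mem ht, ?_⟩
    have hu : u = t⁻¹ • op x • u := by rw [← h, inv_smul_smul]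
    calc t⁻¹ • u = op x⁻¹ • op x • t⁻¹ • u := by
          rw [← mul_smul, ← op_mul, mul_inv_cancel, op_one, one_smul]
      _ = op x⁻¹ • t⁻¹ • op x • u := by rw [smul_comm t⁻¹ (op x) u]
      _ = op x⁻¹ • u := by rw [← hu]

end BisetDefs

/-- If `f : R → G` and `g : R → H` induce surjections from `R` onto `M / N` and `M' / N'` with the
same kernel, then these two quotients are isomorphic. -/
theorem Subgroup.nonempty_quotient_mulEquiv_of_mem_iff {R G H : Type*} [Group R] [Group G] [Group H]
    (f : R →* G) (g : R →* H) {M N : Subgroup G} {M' N' : Subgroup H}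
    [(N.subgroupOf M).Normal] [(N'.subgroupOf M').Normal]
    (hf : ∀ r, f r ∈ M) (hg : ∀ r, g r ∈ M')
    (hfs : ∀ m ∈ M, ∃ r, (f r)⁻¹ * m ∈ N) (hgs : ∀ m ∈ M', ∃ r, (g r)⁻¹ * m ∈ N')
    (h : ∀ r, f r ∈ N ↔ g r ∈ N') :
    Nonempty ((M ⧸ N.subgroupOf M) ≃* (M' ⧸ N'.subgroupOf M')) := by
  let F : R →* M ⧸ N.subgroupOf M := (QuotientGroup.mk' _).comp (f.codRestrict M hf)
  let F' : R →* M' ⧸ N'.subgroupOf M' := (QuotientGroup.mk' _).comp (g.codRestrict M' hg)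
  have hF : Function.Surjective F := by
    rintro ⟨m, hm⟩
    obtain ⟨r, hr⟩ := hfs m hm
    exact ⟨r, QuotientGroup.eq.2 (Subgroup.mem_subgroupOf.2 hr)⟩
  have hF' : Function.Surjective F' := by
    rintro ⟨m, hm⟩
    obtain ⟨r, hr⟩ := hgs m hm
    exact ⟨r, QuotientGroup.eq.2 (Subgroup.mem_subgroupOf.2 hr)⟩
  have hker : F.ker = F'.ker := by
    ext r
    simpa [F, F', MonoidHom.mem_ker, Subgroup.mem_subgroupOf] using h r
  exact ⟨(QuotientGroup.quotientKerEquivOfSurjective F hF).symm.trans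
    ((QuotientGroup.quotientMulEquivOfEq hker).trans
      (QuotientGroup.quotientKerEquivOfSurjective F' hF'))⟩

theorem Subgroup.le_normalizer_of_conj_mem {G : Type*} [Group G] {C H : Subgroup G}
    (h : ∀ c ∈ C, ∀ x ∈ H, c * x * c⁻¹ ∈ H) : C ≤ Subgroup.normalizer (H : Set G) := by
  intro c hc
  refine Subgroup.mem_normalizer_iff.2 fun x => ⟨h c hc x, fun hx => ?_⟩
  simpa [mul_assoc] using h c⁻¹ (C.inv_mem hc) _ hx

theorem Subgroup.le_normalizer_sup {G : Type*} [Group G] {C H K : Subgroup G}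
    (hH : C ≤ Subgroup.normalizer (H : Set G)) (hK : C ≤ Subgroup.normalizer (K : Set G)) :
    C ≤ Subgroup.normalizer ((H ⊔ K : Subgroup G) : Set G) := by
  intro c hc
  rw [Subgroup.mem_normalizer_iff_map_conj_eq, Subgroup.map_sup,
    Subgroup.mem_normalizer_iff_map_conj_eq.1 (hH hc),
    Subgroup.mem_normalizer_iff_map_conj_eq.1 (hK hc)]

theorem Subgroup.inf_le_normalizer_inf {G : Type*} [Group G] {A B A' B' : Subgroup G}
    (hA : A ≤ Subgroup.normalizer (A' : Set G)) (hB : B ≤ Subgroup.normalizer (B' : Set G)) :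
    A ⊓ B ≤ Subgroup.normalizer ((A' ⊓ B' : Subgroup G) : Set G) :=
  Subgroup.le_normalizer_of_conj_mem fun _ hc x hx =>
    ⟨(Subgroup.mem_normalizer_iff.1 (hA hc.1) x).1 hx.1,
      (Subgroup.mem_normalizer_iff.1 (hB hc.2) x).1 hx.2⟩

namespace Biset
variable {Q P U : Type*} [Group Q] [Group P]
variable [MulAction Q U] [MulAction Pᵐᵒᵖ U] [SMulCommClass Q Pᵐᵒᵖ U]

/-- The subgroup `{(y, x) | y • u = u • x}` of `Q × P`. -/
def graph (u : U) : Subgroup (Q × P) where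
  carrier := {p | p.1 • u = op p.2 • u}
  one_mem' := by simp
  mul_mem' := by
    rintro ⟨t, x⟩ ⟨t', x'⟩ (h : t • u = op x • u) (h' : t' • u = op x' • u)
    change (t * t') • u = op (x * x') • u
    rw [mul_smul, h', smul_comm, h, op_mul, mul_smul]
  inv_mem' := by
    rintro ⟨t, x⟩ (h : t • u = op x • u)
    change t⁻¹ • u = op x⁻¹ • u
    rw [inv_smul_eq_iff, smul_comm, h, op_inv, inv_smul_smul]

theorem mem_graph {u : U} {y : Q} {x : P} : (y, x) ∈ graph u ↔ y • u = op x • u := Iff.rfl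

theorem mem_rsub {u : U} {T : Subgroup Q} {x : P} :
    x ∈ rsub u T ↔ ∃ t ∈ T, (t, x) ∈ graph u := Iff.rfl

theorem mem_lsub_top {u : U} {y : Q} :
    y ∈ lsub u (⊤ : Subgroup P) ↔ ∃ x : P, (y, x) ∈ graph u :=
  ⟨fun ⟨x, _, h⟩ => ⟨x, h.symm⟩, fun ⟨x, h⟩ => ⟨x, trivial, h.symm⟩⟩

theorem mem_lsub_bot {u : U} {y : Q} :
    y ∈ lsub u (⊥ : Subgroup P) ↔ (y, (1 : P)) ∈ graph u := by
  refine ⟨fun ⟨x, hx, h⟩ => ?_, fun h => ⟨1, rfl, h.symm⟩⟩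
  rw [Subgroup.mem_bot.1 hx] at h
  exact h.symm

theorem lsub_mono (u : U) {S T : Subgroup P} (h : S ≤ T) : lsub (Q := Q) u S ≤ lsub u T :=
  fun _ ⟨x, hx, hu⟩ => ⟨x, h hx, hu⟩

theorem rsub_mono (u : U) {S T : Subgroup Q} (h : S ≤ T) : rsub (P := P) u S ≤ rsub u T :=
  fun _ ⟨x, hx, hu⟩ => ⟨x, h hx, hu⟩

theorem rsub_le_normalizer_rsub (u : U) {S T : Subgroup Q}
    (hN : T ≤ Subgroup.normalizer (S : Set Q)) :
    rsub (P := P) u T ≤ Subgroup.normalizer (rsub (P := P) u S : Set P) := by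
  refine Subgroup.le_normalizer_of_conj_mem ?_
  rintro x ⟨t, ht, hx⟩ y ⟨s, hs, hy⟩
  exact ⟨t * s * t⁻¹, (Subgroup.mem_normalizer_iff.1 (hN ht) s).1 hs,
    mul_mem (mul_mem (mem_graph.2 hx) (mem_graph.2 hy)) (inv_mem (mem_graph.2 hx))⟩

theorem lsub_top_le_normalizer_lsub_bot (u : U) :
    lsub (Q := Q) u (⊤ : Subgroup P) ≤
      Subgroup.normalizer (lsub (Q := Q) u (⊥ : Subgroup P) : Set Q) := by
  refine Subgroup.le_normalizer_of_conj_mem fun c hc k hk => ?_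
  obtain ⟨x, hx⟩ := mem_lsub_top.1 hc
  have := mul_mem (mul_mem hx (mem_lsub_bot.1 hk)) (inv_mem hx)
  exact mem_lsub_bot.2 (by simpa using this)

/-- For `(t, x)` in the graph, `x ∈ Sᵘ` iff `t` is the product of an element of `S` and an element
of the stabilizer of `u`. -/
theorem mem_rsub_iff_of_mem_graph {u : U} {S : Subgroup Q} {t : Q} {x : P}
    (h : (t, x) ∈ graph u) :
    x ∈ rsub u S ↔ ∃ s ∈ S, s⁻¹ * t ∈ lsub u (⊥ : Subgroup P) := by
  rw [mem_rsub]
  refine exists_congr fun s => and_congr_right fun _ => ?_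
  rw [mem_lsub_bot]
  constructor
  · intro hs
    simpa using mul_mem (inv_mem hs) h
  · intro hs
    simpa using mul_mem h (inv_mem hs)

end Biset

open Pointwise in
/-- Let `U` be a `(Q,P)`-biset, `u ∈ U`, and `(T,S)` a section of `Q` (i.e. `S ⊴ T`).
Then `Sᵘ ⊴ Tᵘ`, the set-product `(S ∩ ᵘP)(T ∩ ᵘ1)` is a normal subgroup of `T ∩ ᵘP`,
the set-product `(T ∩ ᵘ1)S` is a normal subgroup of the subgroup `(T ∩ ᵘP)S` of `T`,
and `Tᵘ/Sᵘ ≅ (T ∩ ᵘP)/((S ∩ ᵘP)(T ∩ ᵘ1)) ≅ (T ∩ ᵘP)S/((T ∩ ᵘ1)S)`.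
In particular `Tᵘ/Sᵘ` is isomorphic to a subquotient of `T/S`.
Here `ᵘP = Biset.lsub u ⊤` and `ᵘ1 = Biset.lsub u ⊥` (the stabilizer of `u` in `Q`). -/
theorem biset_rsub_section {Q P : Type*} [Group Q] [Group P] {U : Type*}
    [MulAction Q U] [MulAction Pᵐᵒᵖ U] [SMulCommClass Q Pᵐᵒᵖ U]
    (u : U) (S T : Subgroup Q) (hST : S ≤ T) (hN : (S.subgroupOf T).Normal) :
    Biset.rsub (P := P) u S ≤ Biset.rsub (P := P) u T ∧
    ∃ _ : ((Biset.rsub (P := P) u S).subgroupOf (Biset.rsub (P := P) u T)).Normal,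
    ∃ N₁ : Subgroup Q,
      (N₁ : Set Q) =
        (↑(S ⊓ Biset.lsub u (⊤ : Subgroup P)) : Set Q) *
          (↑(T ⊓ Biset.lsub u (⊥ : Subgroup P)) : Set Q) ∧
      N₁ ≤ T ⊓ Biset.lsub u (⊤ : Subgroup P) ∧
    ∃ _ : (N₁.subgroupOf (T ⊓ Biset.lsub u (⊤ : Subgroup P))).Normal,
    ∃ N₂ M₂ : Subgroup Q,
      (N₂ : Set Q) = (↑(T ⊓ Biset.lsub u (⊥ : Subgroup P)) : Set Q) * (S : Set Q) ∧
      (M₂ : Set Q) = (↑(T ⊓ Biset.lsub u (⊤ : Subgroup P)) : Set Q) * (S : Set Q) ∧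
      N₂ ≤ M₂ ∧ M₂ ≤ T ∧
    ∃ _ : (N₂.subgroupOf M₂).Normal,
      Nonempty ((↥(Biset.rsub (P := P) u T) ⧸ (Biset.rsub (P := P) u S).subgroupOf (Biset.rsub (P := P) u T)) ≃*
        (↥(T ⊓ Biset.lsub u (⊤ : Subgroup P)) ⧸
          N₁.subgroupOf (T ⊓ Biset.lsub u (⊤ : Subgroup P)))) ∧
      Nonempty ((↥(T ⊓ Biset.lsub u (⊤ : Subgroup P)) ⧸
          N₁.subgroupOf (T ⊓ Biset.lsub u (⊤ : Subgroup P))) ≃*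
        (↥M₂ ⧸ N₂.subgroupOf M₂)) ∧
      ∃ A B : Subgroup (↥T ⧸ S.subgroupOf T), B ≤ A ∧
        ∃ _ : (B.subgroupOf A).Normal,
          Nonempty ((↥(Biset.rsub (P := P) u T) ⧸ (Biset.rsub (P := P) u S).subgroupOf (Biset.rsub (P := P) u T)) ≃*
            (↥A ⧸ B.subgroupOf A)) := by
  set L := Biset.lsub (Q := Q) u (⊤ : Subgroup P)
  set St := Biset.lsub (Q := Q) u (⊥ : Subgroup P)
  set C := T ⊓ L
  set K := T ⊓ St
  have hTS : T ≤ Subgroup.normalizer (S : Set Q) :=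
    (Subgroup.normal_subgroupOf_iff_le_normalizer hST).1 hN
  have hCS : C ≤ Subgroup.normalizer (S : Set Q) := inf_le_left.trans hTS
  have hKC : K ≤ C := inf_le_inf_left _ (Biset.lsub_mono u bot_le)
  have hCK : C ≤ Subgroup.normalizer (K : Set Q) :=
    Subgroup.inf_le_normalizer_inf Subgroup.le_normalizer (Biset.lsub_top_le_normalizer_lsub_bot u)
  have hSLC : S ⊓ L ≤ C := inf_le_inf_right _ hST
  have hCSL : C ≤ Subgroup.normalizer ((S ⊓ L : Subgroup Q) : Set Q) :=
    Subgroup.inf_le_normalizer_inf hTS Subgroup.le_normalizer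
  have hN₁C : (S ⊓ L) ⊔ K ≤ C := sup_le hSLC hKC
  have hN₂M₂ : K ⊔ S ≤ C ⊔ S := sup_le_sup_right hKC S
  have hM₂T : C ⊔ S ≤ T := sup_le inf_le_left hST
  have hM₂N₂ : C ⊔ S ≤ Subgroup.normalizer ((K ⊔ S : Subgroup Q) : Set Q) :=
    sup_le (Subgroup.le_normalizer_sup hCK hCS) (le_sup_right.trans Subgroup.le_normalizer)
  have hcoe₁ := Subgroup.coe_mul_of_left_le_normalizer_right (S ⊓ L) K (hSLC.trans hCK)
  have hcoe₂ := Subgroup.coe_mul_of_left_le_normalizer_right K S (hKC.trans hCS)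
  have hcoe₃ := Subgroup.coe_mul_of_left_le_normalizer_right C S hCS
  have normal₀ : ((Biset.rsub (P := P) u S).subgroupOf (Biset.rsub (P := P) u T)).Normal :=
    (Subgroup.normal_subgroupOf_iff_le_normalizer (Biset.rsub_mono u hST)).2
      (Biset.rsub_le_normalizer_rsub u hTS)
  have normal₁ : (((S ⊓ L) ⊔ K).subgroupOf C).Normal :=
    (Subgroup.normal_subgroupOf_iff_le_normalizer hN₁C).2 (Subgroup.le_normalizer_sup hCSL hCK)
  have normal₂ : ((K ⊔ S).subgroupOf (C ⊔ S)).Normal :=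
    (Subgroup.normal_subgroupOf_iff_le_normalizer hN₂M₂).2 hM₂N₂
  let π : T →* T ⧸ S.subgroupOf T := QuotientGroup.mk' _
  have hBA : (K.subgroupOf T).map π ≤ (C.subgroupOf T).map π :=
    Subgroup.map_mono (Subgroup.comap_mono hKC)
  have normal₃ : (((K.subgroupOf T).map π).subgroupOf ((C.subgroupOf T).map π)).Normal :=
    (Subgroup.normal_subgroupOf_iff_le_normalizer hBA).2
      ((Subgroup.map_mono ((Subgroup.comap_mono hCK).trans
        (Subgroup.le_normalizer_comap T.subtype))).trans (Subgroup.le_normalizer_map π))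
  let R : Subgroup (T × P) := (Biset.graph u).comap (T.subtype.prodMap (MonoidHom.id P))
  let toP : R →* P := (MonoidHom.snd T P).comp R.subtype
  let toT : R →* T := (MonoidHom.fst T P).comp R.subtype
  let toQ : R →* Q := T.subtype.comp toT
  have hR (r : R) : (toQ r, toP r) ∈ Biset.graph u := r.2
  have htoT (r : R) : toQ r ∈ T := (toT r).2
  have htoP (r : R) : toP r ∈ Biset.rsub u T := ⟨toQ r, htoT r, hR r⟩
  have htoC (r : R) : toQ r ∈ C := ⟨htoT r, Biset.mem_lsub_top.2 ⟨toP r, hR r⟩⟩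
  have lift_P : ∀ x ∈ Biset.rsub (P := P) u T, ∃ r, toP r = x :=
    fun x ⟨t, ht, h⟩ => ⟨⟨(⟨t, ht⟩, x), h⟩, rfl⟩
  have lift_C : ∀ t ∈ C, ∃ r, toQ r = t := fun t ⟨ht, h⟩ =>
    let ⟨x, hx⟩ := Biset.mem_lsub_top.1 h
    ⟨⟨(⟨t, ht⟩, x), hx⟩, rfl⟩
  have ker_iff (r : R) : toP r ∈ Biset.rsub u S ↔ ∃ s ∈ S, s⁻¹ * toQ r ∈ K := by
    rw [Biset.mem_rsub_iff_of_mem_graph (hR r)]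
    exact exists_congr fun s => and_congr_right fun hs =>
      ⟨fun h => ⟨T.mul_mem (T.inv_mem (hST hs)) (htoT r), h⟩, fun h => h.2⟩
  have ker₁ (r : R) : toP r ∈ Biset.rsub u S ↔ toQ r ∈ (S ⊓ L) ⊔ K := by
    rw [ker_iff, ← SetLike.mem_coe, hcoe₁, Set.mem_mul]
    constructor
    · rintro ⟨s, hs, hk⟩
      refine ⟨s, ⟨hs, ?_⟩, _, hk, mul_inv_cancel_left _ _⟩
      simpa using L.mul_mem (htoC r).2 (L.inv_mem (hKC hk).2)
    · rintro ⟨s, hs, k, hk, h⟩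
      exact ⟨s, hs.1, by rwa [← h, inv_mul_cancel_left]⟩
  have ker₂ (r : R) : toP r ∈ Biset.rsub u S ↔ toQ r ∈ K ⊔ S := by
    rw [ker₁]
    refine ⟨fun h => (sup_le (inf_le_left.trans le_sup_right) le_sup_left :
      (S ⊓ L) ⊔ K ≤ K ⊔ S) h, fun h => ?_⟩
    rw [← SetLike.mem_coe, hcoe₂] at h
    obtain ⟨k, hk, s, hs, h⟩ := h
    have hsL : s ∈ L := by
      have hs' : s = k⁻¹ * toQ r := by rw [← h]; simp
      exact hs' ▸ L.mul_mem (L.inv_mem (hKC hk).2) (htoC r).2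
    rw [← h]
    exact mul_mem (Subgroup.mem_sup_right hk) (Subgroup.mem_sup_left ⟨hs, hsL⟩)
  have ker₃ (r : R) : toP r ∈ Biset.rsub u S ↔ (π.comp toT) r ∈ (K.subgroupOf T).map π := by
    rw [ker₂, ← SetLike.mem_coe, hcoe₂]
    constructor
    · rintro ⟨k, hk, s, hs, h⟩
      refine ⟨⟨k, hk.1⟩, hk, QuotientGroup.eq.2 (Subgroup.mem_subgroupOf.2 ?_)⟩
      change k⁻¹ * toQ r ∈ S
      rwa [← h, inv_mul_cancel_left]
    · rintro ⟨k, hk, h⟩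
      exact ⟨k, hk, _, Subgroup.mem_subgroupOf.1 (QuotientGroup.eq.1 h), mul_inv_cancel_left _ _⟩
  have surj_P : ∀ x ∈ Biset.rsub (P := P) u T, ∃ r, (toP r)⁻¹ * x ∈ Biset.rsub (P := P) u S := by
    intro x hx
    obtain ⟨r, rfl⟩ := lift_P x hx
    exact ⟨r, by simp [one_mem]⟩
  have surj_C : ∀ t ∈ C, ∃ r, (toQ r)⁻¹ * t ∈ (S ⊓ L) ⊔ K := by
    intro t ht
    obtain ⟨r, rfl⟩ := lift_C t ht
    exact ⟨r, by simp [one_mem]⟩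
  refine ⟨Biset.rsub_mono u hST, normal₀, (S ⊓ L) ⊔ K, hcoe₁, hN₁C, normal₁, K ⊔ S, C ⊔ S,
    hcoe₂, hcoe₃, hN₂M₂, hM₂T, normal₂, ?_, ?_, (C.subgroupOf T).map π, (K.subgroupOf T).map π,
    hBA, normal₃, ?_⟩
  · exact Subgroup.nonempty_quotient_mulEquiv_of_mem_iff toP toQ htoP htoC surj_P surj_C ker₁
  · refine Subgroup.nonempty_quotient_mulEquiv_of_mem_iff toQ toQ htoC
      (fun r => Subgroup.mem_sup_left (htoC r)) surj_C ?_ fun r => (ker₁ r).symm.trans (ker₂ r)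
    intro m hm
    rw [← SetLike.mem_coe, hcoe₃] at hm
    obtain ⟨c, hc, s, hs, rfl⟩ := hm
    obtain ⟨r, rfl⟩ := lift_C c hc
    exact ⟨r, Subgroup.mem_sup_right (by simpa using hs)⟩
  · refine Subgroup.nonempty_quotient_mulEquiv_of_mem_iff toP (π.comp toT) htoP
      (fun r => ⟨toT r, htoC r, rfl⟩) surj_P ?_ ker₃
    rintro _ ⟨t, ht, rfl⟩
    obtain ⟨r, hr⟩ := lift_C t ht
    obtain rfl : toT r = t := Subtype.ext hr
    exact ⟨r, by simp [one_mem]⟩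
end

section
/- Let Q and P be groups, let U be a (Q,P)-biset, let u ∈ U, and let (Y,X) be a section of P (so X is a normal subgroup of Y). Then ᵘX is a normal subgroup of ᵘY, the set-product (X ∩ Qᵘ)(Y ∩ 1ᵘ) is a normal subgroup of Y ∩ Qᵘ, the set-product (Y ∩ 1ᵘ)X is a normal subgroup of the subgroup (Y ∩ Qᵘ)X of Y, and there are group isomorphisms ᵘY/ᵘX ≅ (Y ∩ Qᵘ)/((X ∩ Qᵘ)(Y ∩ 1ᵘ)) ≅ (Y ∩ Qᵘ)X/((Y ∩ 1ᵘ)X). In particular, ᵘY/ᵘX is isomorphic to a subquotient of Y/X, i.e. there exist subgroups B ⊴ A of Y/X with ᵘY/ᵘX ≅ A/B. -/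
open MulOpposite

theorem Subgroup.normal_of_comap_of_surjective {G H : Type*} [Group G] [Group H] {f : G →* H}
    (hf : Function.Surjective f) {B : Subgroup H} (h : (B.comap f).Normal) : B.Normal := by
  rw [← Subgroup.map_comap_eq_self_of_surjective hf B]
  exact h.map f hf

theorem QuotientGroup.nonempty_mulEquiv_of_surjective {G H : Type*} [Group G] [Group H]
    {f : G →* H} (hf : Function.Surjective f) {A : Subgroup G} {B : Subgroup H} [A.Normal]
    [B.Normal] (h : A = B.comap f) : Nonempty ((G ⧸ A) ≃* (H ⧸ B)) := by
  have hk : ((QuotientGroup.mk' B).comp f).ker = A := by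
    rw [← MonoidHom.comap_ker, QuotientGroup.ker_mk', h]
  exact ⟨(QuotientGroup.quotientMulEquivOfEq hk.symm).trans
    (QuotientGroup.quotientKerEquivOfSurjective _
      ((QuotientGroup.mk'_surjective B).comp hf))⟩

/-- If `R ≤ M ≤ R X` inside `Y` and `N = M ∩ T X`, then `M` maps onto the image of `R` in `Y / X`,
and `N` is the preimage of the image of `T`. -/
theorem QuotientGroup.exists_surjective_map_subgroupOf {G : Type*} [Group G]
    {X Y R T M N : Subgroup G} [(X.subgroupOf Y).Normal] (hRM : R ≤ M) (hMY : M ≤ Y) (hTY : T ≤ Y)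
    (hM : ∀ x ∈ M, ∃ t ∈ R, t⁻¹ * x ∈ X) (hN : ∀ x ∈ M, x ∈ N ↔ ∃ t ∈ T, t⁻¹ * x ∈ X) :
    ∃ f : M →* (R.subgroupOf Y).map (QuotientGroup.mk' (X.subgroupOf Y)),
      Function.Surjective f ∧ N.subgroupOf M =
        (((T.subgroupOf Y).map (QuotientGroup.mk' (X.subgroupOf Y))).subgroupOf
          ((R.subgroupOf Y).map (QuotientGroup.mk' (X.subgroupOf Y)))).comap f := by
  have key {S : Subgroup G} (hS : S ≤ Y) (x : Y) :
      QuotientGroup.mk' (X.subgroupOf Y) x ∈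
        (S.subgroupOf Y).map (QuotientGroup.mk' (X.subgroupOf Y)) ↔
      ∃ t ∈ S, t⁻¹ * (x : G) ∈ X := by
    rw [Subgroup.mem_map]
    constructor
    · rintro ⟨t, ht, e⟩
      exact ⟨t, ht, (QuotientGroup.eq (s := X.subgroupOf Y)).1 e⟩
    · rintro ⟨t, ht, e⟩
      exact ⟨⟨t, hS ht⟩, ht, QuotientGroup.eq.2 e⟩
  refine ⟨((QuotientGroup.mk' (X.subgroupOf Y)).comp (Subgroup.inclusion hMY)).codRestrict _
    fun x => (key (hRM.trans hMY) _).2 (hM x x.2), ?_, ?_⟩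
  · rintro ⟨_, r, hr, rfl⟩
    exact ⟨⟨r, hRM hr⟩, rfl⟩
  · ext x
    exact (hN x x.2).trans (key hTY (Subgroup.inclusion hMY x)).symm

section BisetLemmas
variable {Q P : Type*} [Group Q] [Group P]
variable {U : Type*} [MulAction Q U] [MulAction Pᵐᵒᵖ U] [SMulCommClass Q Pᵐᵒᵖ U]

theorem Biset.mem_rsub_s4 {u : U} {T : Subgroup Q} {x : P} :
    x ∈ Biset.rsub u T ↔ ∃ t ∈ T, t • u = op x • u := Iff.rfl

theorem Biset.mem_rsub_bot {u : U} {x : P} :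
    x ∈ Biset.rsub u (⊥ : Subgroup Q) ↔ op x • u = u := by
  simp [Biset.mem_rsub_s4, eq_comm]

theorem Biset.rsub_mono_s4 (u : U) : Monotone (Biset.rsub u : Subgroup Q → Subgroup P) :=
  fun _ _ h _ ⟨t, ht, e⟩ => ⟨t, h ht, e⟩

theorem Biset.lsub_mono_s4 (u : U) : Monotone (Biset.lsub u : Subgroup P → Subgroup Q) :=
  fun _ _ h _ ⟨s, hs, e⟩ => ⟨s, h hs, e⟩

/-- The pairs `(y, x)` with `x ∈ Y` and `y • u = u • x`; this is the stabilizer of `u` in `Q × Y`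
for the action `(y, x) • v = y • v • x⁻¹`. -/
def Biset.stab (u : U) (Y : Subgroup P) : Subgroup (Q × P) where
  carrier := {p | p.2 ∈ Y ∧ p.1 • u = op p.2 • u}
  one_mem' := ⟨Y.one_mem, by simp⟩
  mul_mem' := by
    rintro ⟨y, x⟩ ⟨z, w⟩ ⟨hx, h⟩ ⟨hw, h'⟩
    refine ⟨Y.mul_mem hx hw, ?_⟩
    dsimp only at *
    rw [Prod.mk_mul_mk, op_mul, mul_smul, mul_smul, h', smul_comm y (op w) u, h]
  inv_mem' := by
    rintro ⟨y, x⟩ ⟨hx, h⟩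
    refine ⟨Y.inv_mem hx, ?_⟩
    dsimp only [Prod.inv_mk] at *
    rw [inv_smul_eq_iff, smul_comm y, h, op_inv, inv_smul_smul]

/-- The projection of `Biset.stab u Y` onto its first component. -/
def Biset.stabFst (u : U) (Y : Subgroup P) :
    Biset.stab (Q := Q) u Y →* Biset.lsub (Q := Q) u Y :=
  ((MonoidHom.fst Q P).comp (Biset.stab u Y).subtype).codRestrict _
    fun p => ⟨p.1.2, p.2.1, p.2.2.symm⟩

/-- The projection of `Biset.stab u Y` onto its second component. -/
def Biset.stabSnd (u : U) (Y : Subgroup P) :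
    Biset.stab (Q := Q) u Y →* (Y ⊓ Biset.rsub u (⊤ : Subgroup Q) : Subgroup P) :=
  ((MonoidHom.snd Q P).comp (Biset.stab u Y).subtype).codRestrict _
    fun p => ⟨p.2.1, p.1.1, Subgroup.mem_top _, p.2.2⟩

theorem Biset.stabFst_surjective (u : U) (Y : Subgroup P) :
    Function.Surjective (Biset.stabFst (Q := Q) u Y) :=
  fun ⟨y, x, hx, h⟩ => ⟨⟨(y, x), hx, h.symm⟩, rfl⟩

theorem Biset.stabSnd_surjective (u : U) (Y : Subgroup P) :
    Function.Surjective (Biset.stabSnd (Q := Q) u Y) :=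
  fun ⟨x, hx, y, _, h⟩ => ⟨⟨(y, x), hx, h⟩, rfl⟩

theorem Biset.lsub_subgroupOf_normal (u : U) {X Y : Subgroup P} (hXY : X ≤ Y)
    (hN : (X.subgroupOf Y).Normal) :
    ((Biset.lsub (Q := Q) u X).subgroupOf (Biset.lsub (Q := Q) u Y)).Normal := by
  rw [Subgroup.normal_subgroupOf_iff (Biset.lsub_mono_s4 u hXY)]
  rintro z y ⟨s, hs, hz⟩ ⟨t, ht, hy⟩
  have h₁ : (z, s) ∈ Biset.stab u Y := ⟨hXY hs, hz.symm⟩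
  have h₂ : (y, t) ∈ Biset.stab u Y := ⟨ht, hy.symm⟩
  have h := (mul_mem (mul_mem h₂ h₁) (inv_mem h₂)).2
  exact ⟨t * s * t⁻¹, (Subgroup.normal_subgroupOf_iff hXY).1 hN s t hs ht, h.symm⟩

theorem Biset.comap_stabFst_eq_comap_stabSnd (u : U) {X Y : Subgroup P} (hXY : X ≤ Y)
    {N : Subgroup P} (hN : ∀ x, x ∈ N ↔ ∃ s ∈ X ⊓ Biset.rsub u (⊤ : Subgroup Q),
      ∃ t ∈ Y ⊓ Biset.rsub u (⊥ : Subgroup Q), s * t = x) :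
    ((Biset.lsub (Q := Q) u X).subgroupOf (Biset.lsub (Q := Q) u Y)).comap (Biset.stabFst u Y) =
      (N.subgroupOf (Y ⊓ Biset.rsub u (⊤ : Subgroup Q))).comap (Biset.stabSnd u Y) := by
  ext ⟨⟨y, x⟩, hx, h⟩
  change y ∈ Biset.lsub u X ↔ x ∈ N
  dsimp only at hx h
  rw [hN]
  constructor
  · rintro ⟨s, hs, e⟩
    refine ⟨s, ⟨hs, y, Subgroup.mem_top y, e.symm⟩, s⁻¹ * x,
      ⟨Y.mul_mem (Y.inv_mem (hXY hs)) hx, Biset.mem_rsub_bot.2 ?_⟩, mul_inv_cancel_left s x⟩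
    have h₁ : (y, s) ∈ Biset.stab u Y := ⟨hXY hs, e.symm⟩
    have h₂ : (y, x) ∈ Biset.stab u Y := ⟨hx, h⟩
    simpa using ((Biset.stab u Y).mul_mem ((Biset.stab u Y).inv_mem h₁) h₂).2.symm
  · rintro ⟨s, ⟨hs, -⟩, t, ⟨ht, htu⟩, rfl⟩
    have h₁ : (y, s * t) ∈ Biset.stab u Y := ⟨hx, h⟩
    have h₂ : ((1 : Q), t) ∈ Biset.stab u Y :=
      ⟨ht, by simpa using (Biset.mem_rsub_bot.1 htu).symm⟩
    exact ⟨s, hs, by simpa using (mul_mem h₁ (inv_mem h₂)).2.symm⟩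

end BisetLemmas

open Pointwise in
/-- Let `U` be a `(Q,P)`-biset, `u ∈ U`, and `(Y,X)` a section of `P` (i.e. `X ⊴ Y`).
Then `ᵘX ⊴ ᵘY`, the set-product `(X ∩ Qᵘ)(Y ∩ 1ᵘ)` is a normal subgroup of `Y ∩ Qᵘ`,
the set-product `(Y ∩ 1ᵘ)X` is a normal subgroup of the subgroup `(Y ∩ Qᵘ)X` of `Y`,
and `ᵘY/ᵘX ≅ (Y ∩ Qᵘ)/((X ∩ Qᵘ)(Y ∩ 1ᵘ)) ≅ (Y ∩ Qᵘ)X/((Y ∩ 1ᵘ)X)`.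
In particular `ᵘY/ᵘX` is isomorphic to a subquotient of `Y/X`.
Here `Qᵘ = Biset.rsub u ⊤` and `1ᵘ = Biset.rsub u ⊥` (the stabilizer of `u` in `P`). -/
theorem biset_lsub_section {Q P : Type*} [Group Q] [Group P] {U : Type*}
    [MulAction Q U] [MulAction Pᵐᵒᵖ U] [SMulCommClass Q Pᵐᵒᵖ U]
    (u : U) (X Y : Subgroup P) (hXY : X ≤ Y) (hN : (X.subgroupOf Y).Normal) :
    Biset.lsub (Q := Q) u X ≤ Biset.lsub (Q := Q) u Y ∧
    ∃ _ : ((Biset.lsub (Q := Q) u X).subgroupOf (Biset.lsub (Q := Q) u Y)).Normal,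
    ∃ N₁ : Subgroup P,
      (N₁ : Set P) =
        (↑(X ⊓ Biset.rsub u (⊤ : Subgroup Q)) : Set P) *
          (↑(Y ⊓ Biset.rsub u (⊥ : Subgroup Q)) : Set P) ∧
      N₁ ≤ Y ⊓ Biset.rsub u (⊤ : Subgroup Q) ∧
    ∃ _ : (N₁.subgroupOf (Y ⊓ Biset.rsub u (⊤ : Subgroup Q))).Normal,
    ∃ N₂ M₂ : Subgroup P,
      (N₂ : Set P) = (↑(Y ⊓ Biset.rsub u (⊥ : Subgroup Q)) : Set P) * (X : Set P) ∧
      (M₂ : Set P) = (↑(Y ⊓ Biset.rsub u (⊤ : Subgroup Q)) : Set P) * (X : Set P) ∧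
      N₂ ≤ M₂ ∧ M₂ ≤ Y ∧
    ∃ _ : (N₂.subgroupOf M₂).Normal,
      Nonempty ((↥(Biset.lsub (Q := Q) u Y) ⧸
          (Biset.lsub (Q := Q) u X).subgroupOf (Biset.lsub (Q := Q) u Y)) ≃*
        (↥(Y ⊓ Biset.rsub u (⊤ : Subgroup Q)) ⧸
          N₁.subgroupOf (Y ⊓ Biset.rsub u (⊤ : Subgroup Q)))) ∧
      Nonempty ((↥(Y ⊓ Biset.rsub u (⊤ : Subgroup Q)) ⧸
          N₁.subgroupOf (Y ⊓ Biset.rsub u (⊤ : Subgroup Q))) ≃*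
        (↥M₂ ⧸ N₂.subgroupOf M₂)) ∧
      ∃ A B : Subgroup (↥Y ⧸ X.subgroupOf Y), B ≤ A ∧
        ∃ _ : (B.subgroupOf A).Normal,
          Nonempty ((↥(Biset.lsub (Q := Q) u Y) ⧸
              (Biset.lsub (Q := Q) u X).subgroupOf (Biset.lsub (Q := Q) u Y)) ≃*
            (↥A ⧸ B.subgroupOf A)) := by
  have hYX : Y ≤ Subgroup.normalizer (X : Set P) :=
    (Subgroup.normal_subgroupOf_iff_le_normalizer hXY).1 hN
  have hbot : Biset.rsub u (⊥ : Subgroup Q) ≤ Biset.rsub u (⊤ : Subgroup Q) :=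
    Biset.rsub_mono_s4 (P := P) u bot_le
  have hTR : Y ⊓ Biset.rsub u (⊥ : Subgroup Q) ≤ Y ⊓ Biset.rsub u (⊤ : Subgroup Q) :=
    inf_le_inf_left Y hbot
  have hnorm : Y ⊓ Biset.rsub u (⊥ : Subgroup Q) ≤
      Subgroup.normalizer ((X ⊓ Biset.rsub u (⊤ : Subgroup Q) : Subgroup P) : Set P) :=
    (inf_le_inf hYX (hbot.trans Subgroup.le_normalizer)).trans
      Subgroup.inf_normalizer_le_normalizer_inf
  have hN₁ := Subgroup.coe_mul_of_right_le_normalizer_left _ _ hnorm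
  have hN₂ := Subgroup.coe_mul_of_left_le_normalizer_right
    (Y ⊓ Biset.rsub u (⊥ : Subgroup Q)) X (inf_le_left.trans hYX)
  have hM₂ := Subgroup.coe_mul_of_left_le_normalizer_right
    (Y ⊓ Biset.rsub u (⊤ : Subgroup Q)) X (inf_le_left.trans hYX)
  set N₁ := X ⊓ Biset.rsub u (⊤ : Subgroup Q) ⊔ Y ⊓ Biset.rsub u (⊥ : Subgroup Q)
  set N₂ := Y ⊓ Biset.rsub u (⊥ : Subgroup Q) ⊔ X
  set M₂ := Y ⊓ Biset.rsub u (⊤ : Subgroup Q) ⊔ X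
  have hN₁_mem (x : P) : x ∈ N₁ ↔ ∃ s ∈ X ⊓ Biset.rsub u (⊤ : Subgroup Q),
      ∃ t ∈ Y ⊓ Biset.rsub u (⊥ : Subgroup Q), s * t = x := by
    rw [← SetLike.mem_coe, hN₁, Set.mem_mul]
    rfl
  have hmul_mem {S : Subgroup P} {x : P} :
      x ∈ (S : Set P) * (X : Set P) ↔ ∃ t ∈ S, t⁻¹ * x ∈ X :=
    ⟨fun ⟨t, ht, s, hs, e⟩ => ⟨t, ht, by simpa [← e] using hs⟩,
      fun ⟨t, ht, hs⟩ => ⟨t, ht, _, hs, mul_inv_cancel_left t x⟩⟩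
  have hM₂Y : M₂ ≤ Y := sup_le inf_le_left hXY
  have hL := Biset.lsub_subgroupOf_normal (Q := Q) u hXY hN
  have hcomap := Biset.comap_stabFst_eq_comap_stabSnd (Q := Q) u hXY hN₁_mem
  have hN₁_normal : (N₁.subgroupOf (Y ⊓ Biset.rsub u (⊤ : Subgroup Q))).Normal :=
    Subgroup.normal_of_comap_of_surjective (Biset.stabSnd_surjective u Y)
      (hcomap ▸ hL.comap _)
  obtain ⟨f, hf, hfN⟩ := QuotientGroup.exists_surjective_map_subgroupOf (X := X) (Y := Y)
    (R := Y ⊓ Biset.rsub u (⊤ : Subgroup Q)) (T := Y ⊓ Biset.rsub u (⊥ : Subgroup Q))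
    (N := N₁) le_rfl inf_le_left inf_le_left (fun x hx => ⟨x, hx, by simp⟩) (by
      intro x hx
      rw [hN₁_mem]
      constructor
      · rintro ⟨s, hs, t, ht, rfl⟩
        refine ⟨t, ht, ?_⟩
        simpa [mul_assoc] using
          (Subgroup.mem_normalizer_iff.1 (inv_mem (hYX ht.1)) s).1 hs.1
      · rintro ⟨t, ht, hs⟩
        refine ⟨x * t⁻¹, ⟨?_, mul_mem hx.2 (Subgroup.inv_mem _ (hbot ht.2))⟩, t, ht, by simp⟩
        simpa [mul_assoc] using (Subgroup.mem_normalizer_iff.1 (hYX ht.1) _).1 hs)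
  obtain ⟨g, hg, hgN⟩ := QuotientGroup.exists_surjective_map_subgroupOf (X := X) (Y := Y)
    (R := Y ⊓ Biset.rsub u (⊤ : Subgroup Q)) (T := Y ⊓ Biset.rsub u (⊥ : Subgroup Q))
    (M := M₂) (N := N₂) le_sup_left hM₂Y inf_le_left
    (fun x hx => hmul_mem.1 (hM₂ ▸ hx))
    (fun x _ => by rw [← SetLike.mem_coe, hN₂, hmul_mem])
  have hB_normal := Subgroup.normal_of_comap_of_surjective hf (hfN ▸ hN₁_normal)
  have hN₂_normal : (N₂.subgroupOf M₂).Normal := hgN ▸ hB_normal.comap g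
  have := hL.comap (Biset.stabFst u Y)
  obtain ⟨e₁⟩ := QuotientGroup.nonempty_mulEquiv_of_surjective
    (Biset.stabFst_surjective (Q := Q) u Y)
    (B := (Biset.lsub (Q := Q) u X).subgroupOf (Biset.lsub (Q := Q) u Y)) rfl
  obtain ⟨e₂⟩ := QuotientGroup.nonempty_mulEquiv_of_surjective
    (Biset.stabSnd_surjective (Q := Q) u Y) hcomap
  obtain ⟨e₃⟩ := QuotientGroup.nonempty_mulEquiv_of_surjective hf hfN
  obtain ⟨e₄⟩ := QuotientGroup.nonempty_mulEquiv_of_surjective hg hgN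
  have e := e₁.symm.trans e₂
  exact ⟨Biset.lsub_mono_s4 u hXY, hL, N₁, hN₁,
    sup_le (inf_le_inf_right _ hXY) hTR, hN₁_normal, N₂, M₂, hN₂, hM₂,
    sup_le_sup_right hTR X, hM₂Y, hN₂_normal, ⟨e⟩, ⟨e₃.trans e₄.symm⟩,
    ((Y ⊓ Biset.rsub u (⊤ : Subgroup Q)).subgroupOf Y).map (QuotientGroup.mk' (X.subgroupOf Y)),
    ((Y ⊓ Biset.rsub u (⊥ : Subgroup Q)).subgroupOf Y).map (QuotientGroup.mk' (X.subgroupOf Y)),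
    Subgroup.map_mono (Subgroup.comap_mono hTR), hB_normal, ⟨e.trans e₃⟩⟩
end

section
/- Let P, Q, R be groups, let U be a (Q,P)-biset, let V be an (R,Q)-biset, let u ∈ U, v ∈ V, and let X be a subgroup of P. Then ᵛ(ᵘX) = ^((v,_Q u))X, i.e. the subgroup of R associated to the element (v,_Q u) of the (R,P)-biset V ×_Q U and the subgroup X equals the subgroup of R associated to the element v of V and the subgroup ᵘX of Q. -/
open MulOpposite

section TensorDefs

/-- The relation on `V × U` whose equivalence closure defines the tensor product
`V ×_Q U`: `(v • q, u) ∼ (v, q • u)` for `q ∈ Q`. -/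
def TensorRel (Q : Type*) [Group Q] (V U : Type*) [SMul Qᵐᵒᵖ V] [SMul Q U] :
    V × U → V × U → Prop :=
  fun a b => ∃ q : Q, a.1 = op q • b.1 ∧ b.2 = q • a.2

/-- The tensor product `V ×_Q U` of a right `Q`-set `V` and a left `Q`-set `U`:
the quotient of `V × U` by the equivalence relation generated by `(v • q, u) ∼ (v, q • u)`. -/
def Tensor (Q : Type*) [Group Q] (V U : Type*) [SMul Qᵐᵒᵖ V] [SMul Q U] : Type _ :=
  Quot (TensorRel Q V U)

variable {P Q R : Type*} [Group P] [Group Q] [Group R]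
variable {U : Type*} [MulAction Q U] [MulAction Pᵐᵒᵖ U] [SMulCommClass Q Pᵐᵒᵖ U]
variable {V : Type*} [MulAction R V] [MulAction Qᵐᵒᵖ V] [SMulCommClass R Qᵐᵒᵖ V]

/-- Left `R`-action on `V ×_Q U`: `z • (v ⊗ u) = (z • v) ⊗ u`. -/
instance Tensor.instSMulLeft : SMul R (Tensor Q V U) :=
  ⟨fun z => Quot.map (fun a => (z • a.1, a.2))
    (by rintro a b ⟨q, h1, h2⟩
        refine ⟨q, ?_, h2⟩
        show z • a.1 = op q • (z • b.1)
        rw [h1]; exact smul_comm z (op q) b.1)⟩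

instance Tensor.instMulActionLeft : MulAction R (Tensor Q V U) where
  one_smul x := by
    induction x using Quot.ind with
    | _ a => show Quot.mk _ ((1 : R) • a.1, a.2) = Quot.mk _ a
             rw [one_smul]
  mul_smul z z' x := by
    induction x using Quot.ind with
    | _ a => show Quot.mk _ ((z * z') • a.1, a.2) = Quot.mk _ (z • (z' • a.1), a.2)
             rw [mul_smul]

/-- Right `P`-action on `V ×_Q U`: `(v ⊗ u) • x = v ⊗ (u • x)`. -/
instance Tensor.instSMulRight : SMul Pᵐᵒᵖ (Tensor Q V U) :=
  ⟨fun x => Quot.map (fun a => (a.1, x • a.2))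
    (by rintro a b ⟨q, h1, h2⟩
        refine ⟨q, h1, ?_⟩
        show x • b.2 = q • (x • a.2)
        rw [h2]; exact (smul_comm q x a.2).symm)⟩

instance Tensor.instMulActionRight : MulAction Pᵐᵒᵖ (Tensor Q V U) where
  one_smul x := by
    induction x using Quot.ind with
    | _ a => show Quot.mk _ (a.1, (1 : Pᵐᵒᵖ) • a.2) = Quot.mk _ a
             rw [one_smul]
  mul_smul z z' x := by
    induction x using Quot.ind with
    | _ a => show Quot.mk _ (a.1, (z * z') • a.2) = Quot.mk _ (a.1, z • (z' • a.2))
             rw [mul_smul]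

/-- The two actions on `V ×_Q U` commute, so `V ×_Q U` is an `(R,P)`-biset. -/
instance Tensor.instSMulCommClass : SMulCommClass R Pᵐᵒᵖ (Tensor Q V U) :=
  ⟨fun z x t => by induction t using Quot.ind with | _ a => rfl⟩

end TensorDefs

theorem TensorRel.equivalence (Q : Type*) [Group Q] (V U : Type*) [MulAction Qᵐᵒᵖ V]
    [MulAction Q U] : Equivalence (TensorRel Q V U) where
  refl a := ⟨1, by simp, by simp⟩
  symm := by
    rintro a b ⟨q, h₁, h₂⟩
    exact ⟨q⁻¹, by rw [h₁, op_inv, inv_smul_smul], by rw [h₂, inv_smul_smul]⟩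
  trans := by
    rintro a b c ⟨q, h₁, h₂⟩ ⟨r, h₃, h₄⟩
    exact ⟨r * q, by rw [h₁, h₃, op_mul, mul_smul], by rw [h₄, h₂, mul_smul]⟩

theorem Tensor.mk_eq_mk_iff {Q : Type*} [Group Q] {V U : Type*} [MulAction Qᵐᵒᵖ V]
    [MulAction Q U] {a b : V × U} :
    Quot.mk (TensorRel Q V U) a = Quot.mk (TensorRel Q V U) b ↔ TensorRel Q V U a b :=
  (TensorRel.equivalence Q V U).quot_mk_eq_iff a b

/-- Let `U` be a `(Q,P)`-biset, `V` an `(R,Q)`-biset, `u ∈ U`, `v ∈ V`, and `X ≤ P`.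
Then `^((v,_Q u))X = ᵛ(ᵘX)`: the subgroup of `R` associated to the element
`(v,_Q u)` of the `(R,P)`-biset `V ×_Q U` and the subgroup `X` of `P` equals the
subgroup of `R` associated to `v ∈ V` and the subgroup `ᵘX` of `Q`. -/
theorem biset_lsub_tensor {P Q R : Type*} [Group P] [Group Q] [Group R]
    {U : Type*} [MulAction Q U] [MulAction Pᵐᵒᵖ U] [SMulCommClass Q Pᵐᵒᵖ U]
    {V : Type*} [MulAction R V] [MulAction Qᵐᵒᵖ V] [SMulCommClass R Qᵐᵒᵖ V]
    (u : U) (v : V) (X : Subgroup P) :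
    Biset.lsub (Q := R) (U := Tensor Q V U) (Quot.mk (TensorRel Q V U) (v, u)) X =
      Biset.lsub (Q := R) v (Biset.lsub (Q := Q) u X) := by
  ext z
  constructor
  · rintro ⟨s, hs, h⟩
    obtain ⟨q, hv, hu⟩ := Tensor.mk_eq_mk_iff.mp h
    refine ⟨q⁻¹, ⟨s, hs, eq_inv_smul_iff.mpr hu.symm⟩, ?_⟩
    rw [op_inv]
    exact inv_smul_eq_iff.mpr hv
  · rintro ⟨y, ⟨s, hs, hu⟩, hv⟩
    refine ⟨s, hs, Tensor.mk_eq_mk_iff.mpr ⟨y⁻¹, ?_, ?_⟩⟩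
    · rw [op_inv]
      exact eq_inv_smul_iff.mpr hv
    · exact eq_inv_smul_iff.mpr hu.symm
end

section
/- Let P, Q, R be groups, let U be a (Q,P)-biset, let V be an (R,Q)-biset, let u ∈ U, v ∈ V, and let Z be a subgroup of R. Then (Zᵛ)ᵘ = Z^((v,_Q u)), i.e. the subgroup of P associated to the element (v,_Q u) of the (R,P)-biset V ×_Q U and the subgroup Z equals the subgroup of P associated to the element u of U and the subgroup Zᵛ of Q. -/
open MulOpposite

/-- Let `U` be a `(Q,P)`-biset, `V` an `(R,Q)`-biset, `u ∈ U`, `v ∈ V`, and `Z ≤ R`.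
Then `Z^((v,_Q u)) = (Zᵛ)ᵘ`: the subgroup of `P` associated to the element
`(v,_Q u)` of the `(R,P)`-biset `V ×_Q U` and the subgroup `Z` of `R` equals the
subgroup of `P` associated to `u ∈ U` and the subgroup `Zᵛ` of `Q`. -/
theorem biset_rsub_tensor {P Q R : Type*} [Group P] [Group Q] [Group R]
    {U : Type*} [MulAction Q U] [MulAction Pᵐᵒᵖ U] [SMulCommClass Q Pᵐᵒᵖ U]
    {V : Type*} [MulAction R V] [MulAction Qᵐᵒᵖ V] [SMulCommClass R Qᵐᵒᵖ V]
    (u : U) (v : V) (Z : Subgroup R) :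
    Biset.rsub (P := P) (U := Tensor Q V U) (Quot.mk (TensorRel Q V U) (v, u)) Z =
      Biset.rsub (P := P) u (Biset.rsub (P := Q) v Z) := by
  ext x
  constructor
  · rintro ⟨z, hz, h⟩
    obtain ⟨q, hv, hu⟩ := Tensor.mk_eq_mk_iff.mp h
    exact ⟨q, ⟨z, hz, hv⟩, hu.symm⟩
  · rintro ⟨q, ⟨z, hz, hv⟩, hu⟩
    exact ⟨z, hz, Tensor.mk_eq_mk_iff.mpr ⟨q, hv, hu.symm⟩⟩
end

section
/- Let Q and P be groups, let U be a (Q,P)-biset, let u ∈ U, let T be a subgroup of Q and T' a subgroup of T. Then for every t ∈ T, the set {a • ((t • u) • x) | a ∈ T', x ∈ Tᵘ} ⊆ U equals {b • u | b ∈ T' t (T ∩ ᵘP)}; consequently, for t, t' ∈ T the (T',Tᵘ)-orbits of t • u and t' • u in U coincide if and only if the double cosets T' t (T ∩ ᵘP) and T' t' (T ∩ ᵘP) in T coincide. -/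
open MulOpposite

section BisetLemmas
variable {Q P : Type*} [Group Q] [Group P]
variable {U : Type*} [MulAction Q U] [MulAction Pᵐᵒᵖ U] [SMulCommClass Q Pᵐᵒᵖ U]

theorem Biset.mem_lsub {u : U} {S : Subgroup P} {y : Q} :
    y ∈ Biset.lsub u S ↔ ∃ s ∈ S, op s • u = y • u := Iff.rfl

theorem Biset.mem_lsub_of_smul_eq {u : U} (S : Subgroup P) {y : Q} (h : y • u = u) :
    y ∈ Biset.lsub u S :=
  Biset.mem_lsub.2 ⟨1, S.one_mem, by rw [op_one, one_smul, h]⟩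

theorem Biset.smul_op_smul_smul {u : U} {a t c : Q} {x : P} (h : c • u = op x • u) :
    a • op x • t • u = (a * t * c) • u := by
  rw [mul_smul, mul_smul, h, smul_comm t (op x) u]

theorem Biset.orbit_eq_smul_doubleCoset (u : U) (T T' : Subgroup Q) (t : Q) :
    {w : U | ∃ a ∈ T', ∃ x ∈ Biset.rsub (P := P) u T, w = a • op x • t • u} =
    {w : U | ∃ b ∈ T', ∃ c ∈ T ⊓ Biset.lsub u (⊤ : Subgroup P), w = (b * t * c) • u} := by
  ext w
  constructor
  · rintro ⟨a, ha, x, ⟨c, hc, h⟩, rfl⟩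
    exact ⟨a, ha, c, ⟨hc, x, Subgroup.mem_top x, h.symm⟩, Biset.smul_op_smul_smul h⟩
  · rintro ⟨a, ha, c, ⟨hc, x, -, h⟩, rfl⟩
    exact ⟨a, ha, x, ⟨c, hc, h.symm⟩, (Biset.smul_op_smul_smul h.symm).symm⟩

theorem Biset.smul_mem_smul_doubleCoset_iff (u : U) {T T' : Subgroup Q} (hT' : T' ≤ T)
    {t : Q} (ht : t ∈ T) (b : Q) :
    (b ∈ T ∧ ∃ a ∈ T', ∃ c ∈ T ⊓ Biset.lsub u (⊤ : Subgroup P), b • u = (a * t * c) • u) ↔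
      ∃ a ∈ T', ∃ c ∈ T ⊓ Biset.lsub u (⊤ : Subgroup P), b = a * t * c := by
  constructor
  · rintro ⟨hb, a, ha, c, hc, h⟩
    have hd : (a * t * c)⁻¹ * b ∈ T ⊓ Biset.lsub u (⊤ : Subgroup P) :=
      ⟨T.mul_mem (T.inv_mem (T.mul_mem (T.mul_mem (hT' ha) ht) hc.1)) hb,
        Biset.mem_lsub_of_smul_eq _ (by rw [mul_smul, h, inv_smul_smul])⟩
    exact ⟨a, ha, _, mul_mem hc hd, by group⟩
  · rintro ⟨a, ha, c, hc, rfl⟩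
    exact ⟨T.mul_mem (T.mul_mem (hT' ha) ht) hc.1, a, ha, c, hc, rfl⟩

end BisetLemmas

/-- Let `U` be a `(Q,P)`-biset, `u ∈ U`, `T ≤ Q` and `T' ≤ T`.  For every `t ∈ T`, the
`(T', Tᵘ)`-orbit `{a • ((t • u) • x) | a ∈ T', x ∈ Tᵘ}` of `t • u` equals
`{b • u | b ∈ T' t (T ∩ ᵘP)}`; consequently, for `t, t' ∈ T` the `(T', Tᵘ)`-orbits of
`t • u` and `t' • u` coincide iff the double cosets `T' t (T ∩ ᵘP)` and `T' t' (T ∩ ᵘP)`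
in `T` coincide.  Here `ᵘP = Biset.lsub u ⊤` and `Tᵘ = Biset.rsub u T`. -/
theorem biset_orbit_double_coset {Q P : Type*} [Group Q] [Group P] {U : Type*}
    [MulAction Q U] [MulAction Pᵐᵒᵖ U] [SMulCommClass Q Pᵐᵒᵖ U]
    (u : U) (T T' : Subgroup Q) (hT' : T' ≤ T) :
    (∀ t ∈ T,
      {w : U | ∃ a ∈ T', ∃ x ∈ Biset.rsub (P := P) u T, w = a • op x • t • u} =
      {w : U | ∃ b ∈ T', ∃ c ∈ T ⊓ Biset.lsub u (⊤ : Subgroup P), w = (b * t * c) • u}) ∧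
    (∀ t ∈ T, ∀ t' ∈ T,
      ({w : U | ∃ a ∈ T', ∃ x ∈ Biset.rsub (P := P) u T, w = a • op x • t • u} =
       {w : U | ∃ a ∈ T', ∃ x ∈ Biset.rsub (P := P) u T, w = a • op x • t' • u} ↔
       {b : Q | ∃ a ∈ T', ∃ c ∈ T ⊓ Biset.lsub u (⊤ : Subgroup P), b = a * t * c} =
       {b : Q | ∃ a ∈ T', ∃ c ∈ T ⊓ Biset.lsub u (⊤ : Subgroup P), b = a * t' * c})) := by
  refine ⟨fun t _ => Biset.orbit_eq_smul_doubleCoset u T T' t, fun t ht t' ht' => ?_⟩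
  rw [Biset.orbit_eq_smul_doubleCoset, Biset.orbit_eq_smul_doubleCoset]
  constructor
  · intro h
    ext b
    simp only [Set.mem_ofPred_eq]
    rw [← Biset.smul_mem_smul_doubleCoset_iff u hT' ht,
      ← Biset.smul_mem_smul_doubleCoset_iff u hT' ht']
    exact and_congr_right fun _ => Set.ext_iff.1 h (b • u)
  · intro h
    have image_eq (s : Q) :
        {w : U | ∃ a ∈ T', ∃ c ∈ T ⊓ Biset.lsub u (⊤ : Subgroup P), w = (a * s * c) • u} =
        (· • u) '' {b : Q | ∃ a ∈ T', ∃ c ∈ T ⊓ Biset.lsub u (⊤ : Subgroup P),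
          b = a * s * c} := by
      ext w
      constructor
      · rintro ⟨a, ha, c, hc, rfl⟩
        exact ⟨_, ⟨a, ha, c, hc, rfl⟩, rfl⟩
      · rintro ⟨_, ⟨a, ha, c, hc, rfl⟩, rfl⟩
        exact ⟨a, ha, c, hc, rfl⟩
    rw [image_eq, image_eq, h]
end
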